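/- Let f₁,…,fₘ be measurable functions on ℝ₊ with fⱼ ∈ Gψⱼ(aⱼ,bⱼ), and let Q be measurable and homogeneous of degree −m. Suppose p₁,…,pₘ with pⱼ ∈ (aⱼ,bⱼ), ∑ 1/pⱼ = 1/p, p ≥ 1, and Θ_m(p₁,…,pₘ) < ∞. Then ‖M(f₁,…,fₘ)‖_{L^p(ℝ₊)} ≤ Θ_m(p₁,…,pₘ) · ∏_{j=1}^m ψⱼ(pⱼ) ‖fⱼ‖_{Gψⱼ}. -/

import Mathlib

open MeasureTheory ENNReal Set

/-- Lebesgue measure restricted to `(0,∞)`. -/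
noncomputable def muHalf : Measure ℝ := (volume : Measure ℝ).restrict (Ioi 0)

/-- The product measure on `ℝ₊^m`. -/
noncomputable def piHalf (m : ℕ) : Measure (Fin m → ℝ) :=
  Measure.pi fun _ => muHalf

/-- `Θ_m(p⃗) = ∫_{ℝ₊^m} |Q(1,x⃗)| ∏ xⱼ^{-1/pⱼ} dx⃗`. -/
noncomputable def Theta (m : ℕ) (Q : ℝ → (Fin m → ℝ) → ℝ) (p : Fin m → ℝ) : ℝ≥0∞ :=
  ∫⁻ xs, ENNReal.ofReal (|Q 1 xs| * ∏ j, (xs j) ^ (-(1 / p j))) ∂(piHalf m)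

/-- The Grand Lebesgue norm `‖f‖_{Gψ} = sup_{p ∈ (a,b)} ‖f‖_{L^p(μ)}/ψ(p)`. -/
noncomputable def grandNorm {Ω : Type*} [MeasurableSpace Ω] (μ : Measure Ω)
    (a : ℝ) (b : ℝ≥0∞) (ψ : ℝ → ℝ) (f : Ω → ℝ) : ℝ≥0∞ :=
  ⨆ p : {p : ℝ // a < p ∧ (ENNReal.ofReal p) < b},
    eLpNorm f (ENNReal.ofReal p.1) μ / ENNReal.ofReal (ψ p.1)

instance : SigmaFinite muHalf := by unfold muHalf; infer_instance

instance (m : ℕ) : SigmaFinite (piHalf m) := by unfold piHalf; infer_instance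

theorem piHalf_eq_restrict (m : ℕ) :
    piHalf m = (volume : Measure (Fin m → ℝ)).restrict (univ.pi fun _ => Ioi 0) := by
  simp only [piHalf, muHalf]
  rw [← Measure.restrict_pi_pi, volume_pi]

theorem ae_piHalf_pos (m : ℕ) : ∀ᵐ y ∂(piHalf m), ∀ j, 0 < y j := by
  rw [piHalf_eq_restrict]
  filter_upwards [ae_restrict_mem (MeasurableSet.univ_pi fun _ => measurableSet_Ioi)] with y hy j
  exact hy j (mem_univ j)

/-- Change of variables under a dilation, on a set invariant under it. -/
theorem setLIntegral_comp_smul {E : Type*} [NormedAddCommGroup E] [NormedSpace ℝ E]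
    [FiniteDimensional ℝ E] [MeasurableSpace E] [BorelSpace E] (μ : Measure E) [μ.IsAddHaarMeasure]
    {S : Set E} (hS : MeasurableSet S) {r : ℝ} (hr : r ≠ 0) (hrS : ∀ y, r • y ∈ S ↔ y ∈ S)
    {F : E → ℝ≥0∞} (hF : Measurable F) :
    ∫⁻ y in S, F (r • y) ∂μ
      = ENNReal.ofReal |(r ^ Module.finrank ℝ E)⁻¹| * ∫⁻ y in S, F y ∂μ := by
  have h : ∀ y, S.indicator (fun y => F (r • y)) y = S.indicator F (r • y) := fun y => by
    by_cases hy : y ∈ S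
    · rw [indicator_of_mem hy, indicator_of_mem ((hrS y).2 hy)]
    · rw [indicator_of_notMem hy, indicator_of_notMem (mt (hrS y).1 hy)]
  rw [← lintegral_indicator hS, ← lintegral_indicator hS, lintegral_congr h,
    ← lintegral_map (hF.indicator hS) (measurable_const_smul r), Measure.map_addHaar_smul μ hr,
    lintegral_smul_measure, smul_eq_mul]

theorem lintegral_muHalf_comp_mul {r : ℝ} (hr : 0 < r) {F : ℝ → ℝ≥0∞} (hF : Measurable F) :
    ∫⁻ x, F (x * r) ∂muHalf = ENNReal.ofReal r⁻¹ * ∫⁻ x, F x ∂muHalf := by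
  have := setLIntegral_comp_smul volume measurableSet_Ioi hr.ne'
    (fun y => by simp [mul_pos_iff_of_pos_left hr] : ∀ y : ℝ, r • y ∈ Ioi (0 : ℝ) ↔ y ∈ Ioi 0) hF
  simpa [muHalf, mul_comm r, abs_of_pos hr] using this

theorem lintegral_piHalf_comp_smul (m : ℕ) {r : ℝ} (hr : 0 < r) {F : (Fin m → ℝ) → ℝ≥0∞}
    (hF : Measurable F) :
    ∫⁻ y, F (r • y) ∂(piHalf m) = ENNReal.ofReal (r ^ m)⁻¹ * ∫⁻ y, F y ∂(piHalf m) := by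
  have := setLIntegral_comp_smul (volume : Measure (Fin m → ℝ))
    (S := univ.pi fun _ => Ioi 0) (MeasurableSet.univ_pi fun _ => measurableSet_Ioi) hr.ne'
    (fun y => by simp [mul_pos_iff_of_pos_left hr]) hF
  simpa [piHalf_eq_restrict, abs_of_pos hr] using this

/-- An integral Minkowski inequality: if the slices `G · y` have `L^q` norm at most `k y * C`, then
averaging them against `K` gives a function of `L^q` norm at most `(∫ K k) * C`. -/
theorem lintegral_rpow_lintegral_mul_le {α β : Type*} [MeasurableSpace α] [MeasurableSpace β]
    {μ : Measure α} {ν : Measure β} [SFinite μ] [SFinite ν] {q : ℝ} (hq : 1 ≤ q)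
    {K k : β → ℝ≥0∞} {G : α → β → ℝ≥0∞} {C : ℝ≥0∞} (hK : Measurable K) (hk : Measurable k)
    (hG : Measurable (Function.uncurry G)) (hk0 : ∀ᵐ y ∂ν, k y ≠ 0 ∧ k y ≠ ∞)
    (hGC : ∀ᵐ y ∂ν, ∫⁻ x, G x y ^ q ∂μ ≤ (k y * C) ^ q) :
    ∫⁻ x, (∫⁻ y, K y * G x y ∂ν) ^ q ∂μ ≤ ((∫⁻ y, K y * k y ∂ν) * C) ^ q := by
  have hq0 : 0 < q := by linarith
  set T := ∫⁻ y, K y * k y ∂ν with hT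
  have hinv : 0 ≤ 1 - 1 / q := by
    rw [sub_nonneg, div_le_one hq0]; exact hq
  have hJensen : ∀ x, (∫⁻ y, K y * G x y ∂ν) ^ q
      ≤ T ^ (q - 1) * ∫⁻ y, K y * k y * (G x y * (k y)⁻¹) ^ q ∂ν := by
    intro x
    have hGx : Measurable (G x) := hG.of_uncurry_left
    have h1 : ∫⁻ y, K y * G x y ∂ν = ∫⁻ y, (K y * k y) ^ (1 - 1 / q) *
        (K y * k y * (G x y * (k y)⁻¹) ^ q) ^ (1 / q) ∂ν := by
      refine lintegral_congr_ae ?_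
      filter_upwards [hk0] with y hy
      rw [ENNReal.mul_rpow_of_nonneg (K y * k y) _ (by positivity : 0 ≤ 1 / q),
        ← ENNReal.rpow_mul, mul_one_div_cancel hq0.ne', ENNReal.rpow_one, ← mul_assoc,
        ← ENNReal.rpow_add_of_nonneg _ _ hinv (by positivity), sub_add_cancel, ENNReal.rpow_one]
      calc K y * G x y = K y * G x y * (k y * (k y)⁻¹) := by
            rw [ENNReal.mul_inv_cancel hy.1 hy.2, mul_one]
        _ = _ := by ring
    have h2 := ENNReal.lintegral_mul_norm_pow_le (μ := ν) (f := fun y => K y * k y)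
      (g := fun y => K y * k y * (G x y * (k y)⁻¹) ^ q) (by fun_prop) (by fun_prop) hinv
      (by positivity : 0 ≤ 1 / q) (by ring)
    rw [← h1, ← hT] at h2
    calc _ ≤ _ := ENNReal.rpow_le_rpow h2 hq0.le
      _ = _ := by
        rw [ENNReal.mul_rpow_of_nonneg _ _ hq0.le, ← ENNReal.rpow_mul, ← ENNReal.rpow_mul,
          one_div_mul_cancel hq0.ne', ENNReal.rpow_one]
        congr 2
        field_simp
  calc _ ≤ _ := lintegral_mono hJensen
    _ = T ^ (q - 1) * ∫⁻ y, ∫⁻ x, K y * k y * (G x y * (k y)⁻¹) ^ q ∂μ ∂ν := by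
      have hmeas : Measurable (Function.uncurry fun x y =>
          K y * k y * (G x y * (k y)⁻¹) ^ q) := by
        simp only [Function.uncurry_def] at hG ⊢
        fun_prop
      rw [lintegral_const_mul _ hmeas.lintegral_prod_right, lintegral_lintegral_swap
        hmeas.aemeasurable]
    _ ≤ T ^ (q - 1) * ∫⁻ y, K y * k y * C ^ q ∂ν := by
      refine mul_le_mul_right (lintegral_mono_ae ?_) _
      filter_upwards [hk0, hGC] with y hy hyC
      have hGy : Measurable fun x => G x y := hG.of_uncurry_right
      rw [lintegral_const_mul _ (by fun_prop)]
      refine mul_le_mul_right ?_ _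
      simp only [ENNReal.mul_rpow_of_nonneg _ _ hq0.le] at hyC ⊢
      rw [lintegral_mul_const _ (by fun_prop)]
      calc _ ≤ k y ^ q * C ^ q * (k y)⁻¹ ^ q := mul_le_mul_left hyC _
        _ = (k y * (k y)⁻¹) ^ q * C ^ q := by
          rw [ENNReal.mul_rpow_of_nonneg _ _ hq0.le]; ring
        _ = C ^ q := by rw [ENNReal.mul_inv_cancel hy.1 hy.2, ENNReal.one_rpow, one_mul]
    _ = (T * C) ^ q := by
      rw [lintegral_mul_const _ (by fun_prop), ← hT, ENNReal.mul_rpow_of_nonneg _ _ hq0.le,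
        ← mul_assoc]
      congr 1
      conv_lhs => rw [← ENNReal.rpow_one T]
      rw [← ENNReal.rpow_mul, one_mul, ← ENNReal.rpow_add_of_nonneg _ _ (by linarith) zero_le_one,
        sub_add_cancel]

/-- Hölder's inequality for a finite product. -/
theorem lintegral_prod_rpow_le {α ι : Type*} [MeasurableSpace α] [Fintype ι] {μ : Measure α}
    {p : ι → ℝ} {q : ℝ} (hp : ∀ j, 0 < p j) (hq : 0 < q) (hqp : 1 / q = ∑ j, 1 / p j)
    {h : ι → α → ℝ≥0∞} (hh : ∀ j, Measurable (h j)) :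
    ∫⁻ x, (∏ j, h j x) ^ q ∂μ ≤ (∏ j, (∫⁻ x, h j x ^ p j ∂μ) ^ (1 / p j)) ^ q := by
  have hH := ENNReal.lintegral_prod_norm_pow_le (μ := μ) Finset.univ
    (f := fun j x => h j x ^ p j) (fun j _ => ((hh j).pow_const _).aemeasurable)
    (p := fun j => 1 / p j * q) (by rw [← Finset.sum_mul, ← hqp, one_div_mul_cancel hq.ne'])
    (fun j _ => mul_nonneg (one_div_nonneg.2 (hp j).le) hq.le)
  simp only [← ENNReal.prod_rpow_of_nonneg hq.le]
  refine le_trans (le_of_eq ?_) (hH.trans (le_of_eq ?_))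
  · refine lintegral_congr fun x => Finset.prod_congr rfl fun j _ => ?_
    rw [← ENNReal.rpow_mul, ← mul_assoc, mul_one_div_cancel (hp j).ne', one_mul]
  · exact Finset.prod_congr rfl fun j _ => ENNReal.rpow_mul _ _ _

theorem lintegral_prod_comp_mul_rpow_le {m : ℕ} {p : Fin m → ℝ} {q : ℝ} (hp : ∀ j, 0 < p j)
    (hq : 0 < q) (hqp : 1 / q = ∑ j, 1 / p j) {h : Fin m → ℝ → ℝ≥0∞}
    (hh : ∀ j, Measurable (h j)) {y : Fin m → ℝ} (hy : ∀ j, 0 < y j) :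
    ∫⁻ x, (∏ j, h j (x * y j)) ^ q ∂muHalf
      ≤ (ENNReal.ofReal (∏ j, y j ^ (-(1 / p j))) *
        ∏ j, (∫⁻ x, h j x ^ p j ∂muHalf) ^ (1 / p j)) ^ q := by
  refine (lintegral_prod_rpow_le hp hq hqp (h := fun j x => h j (x * y j))
    fun j => (hh j).comp (measurable_mul_const _)).trans (le_of_eq ?_)
  rw [ENNReal.ofReal_prod_of_nonneg fun j _ => Real.rpow_nonneg (hy j).le _,
    ← Finset.prod_mul_distrib]
  congr 1
  refine Finset.prod_congr rfl fun j _ => ?_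
  rw [lintegral_muHalf_comp_mul (hy j) ((hh j).pow_const (p j)),
    ENNReal.mul_rpow_of_nonneg _ _ (one_div_nonneg.2 (hp j).le),
    ENNReal.ofReal_rpow_of_pos (inv_pos.2 (hy j)), Real.inv_rpow (hy j).le,
    Real.rpow_neg (hy j).le]

theorem lintegral_kernel_eq {m : ℕ} {Q : ℝ → (Fin m → ℝ) → ℝ}
    (hQ : Measurable (fun z : ℝ × (Fin m → ℝ) => Q z.1 z.2))
    (hhom : ∀ δ > (0:ℝ), ∀ x > (0:ℝ), ∀ xs : Fin m → ℝ, (∀ j, 0 < xs j) →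
      Q (δ * x) (fun j => δ * xs j) = δ ^ (-(m:ℝ)) * Q x xs)
    {h : Fin m → ℝ → ℝ≥0∞} (hh : ∀ j, Measurable (h j)) {x : ℝ} (hx : 0 < x) :
    ∫⁻ xs, ‖Q x xs‖ₑ * ∏ j, h j (xs j) ∂(piHalf m)
      = ∫⁻ y, ‖Q 1 y‖ₑ * ∏ j, h j (x * y j) ∂(piHalf m) := by
  have hQx : Measurable (Q x) := hQ.comp measurable_prodMk_left
  have hpos : (0 : ℝ) < x ^ m := pow_pos hx m
  have hF : Measurable fun xs : Fin m → ℝ => ‖Q x xs‖ₑ * ∏ j, h j (xs j) :=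
    hQx.enorm.mul (Finset.measurable_prod _ fun j _ => (hh j).comp (measurable_pi_apply j))
  have hcv := lintegral_piHalf_comp_smul m hx hF
  have hlhs : ∫⁻ y, ‖Q x (x • y)‖ₑ * ∏ j, h j ((x • y) j) ∂(piHalf m)
      = ENNReal.ofReal (x ^ m)⁻¹ * ∫⁻ y, ‖Q 1 y‖ₑ * ∏ j, h j (x * y j) ∂(piHalf m) := by
    rw [← lintegral_const_mul' _ _ ENNReal.ofReal_ne_top]
    refine lintegral_congr_ae ?_
    filter_upwards [ae_piHalf_pos m] with y hy
    have hQy : Q x (x • y) = (x ^ m)⁻¹ * Q 1 y := by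
      have := hhom x hx 1 one_pos y hy
      rwa [mul_one, Real.rpow_neg hx.le, Real.rpow_natCast] at this
    rw [hQy, enorm_mul, Real.enorm_of_nonneg (inv_pos.2 hpos).le, mul_assoc]
    rfl
  rw [hlhs] at hcv
  exact ((ENNReal.mul_right_inj (by simpa using hpos) ENNReal.ofReal_ne_top).1 hcv).symm

theorem Theta_eq (m : ℕ) (Q : ℝ → (Fin m → ℝ) → ℝ) (p : Fin m → ℝ) :
    Theta m Q p
      = ∫⁻ y, ‖Q 1 y‖ₑ * ENNReal.ofReal (∏ j, y j ^ (-(1 / p j))) ∂(piHalf m) := by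
  refine lintegral_congr fun y => ?_
  rw [ENNReal.ofReal_mul (abs_nonneg _), Real.enorm_eq_ofReal_abs]

theorem eLpNorm_ofReal_eq {α : Type*} [MeasurableSpace α] {μ : Measure α} {r : ℝ} (hr : 0 < r)
    (f : α → ℝ) : eLpNorm f (ENNReal.ofReal r) μ = (∫⁻ x, ‖f x‖ₑ ^ r ∂μ) ^ (1 / r) := by
  rw [eLpNorm_eq_lintegral_rpow_enorm_toReal (by simpa using hr) ENNReal.ofReal_ne_top,
    ENNReal.toReal_ofReal hr.le]

/-- The multilinear operator with homogeneous kernel maps `L^{p₁} × ⋯ × L^{pₘ}` to `L^q`. -/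
theorem eLpNorm_kernel_le {m : ℕ} {Q : ℝ → (Fin m → ℝ) → ℝ}
    (hQ : Measurable (fun z : ℝ × (Fin m → ℝ) => Q z.1 z.2))
    (hhom : ∀ δ > (0:ℝ), ∀ x > (0:ℝ), ∀ xs : Fin m → ℝ, (∀ j, 0 < xs j) →
      Q (δ * x) (fun j => δ * xs j) = δ ^ (-(m:ℝ)) * Q x xs)
    {f : Fin m → ℝ → ℝ} (hf : ∀ j, AEStronglyMeasurable (f j) muHalf)
    {p : Fin m → ℝ} {q : ℝ} (hp : ∀ j, 0 < p j) (hq : 1 ≤ q) (hqp : 1 / q = ∑ j, 1 / p j) :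
    eLpNorm (fun x => ∫ xs, Q x xs * ∏ j, f j (xs j) ∂(piHalf m)) (ENNReal.ofReal q) muHalf
      ≤ Theta m Q p * ∏ j, eLpNorm (f j) (ENNReal.ofReal (p j)) muHalf := by
  have hq0 : 0 < q := by linarith
  choose g hg hfg using hf
  have hae : ∀ᵐ xs ∂(piHalf m), ∀ j, f j (xs j) = g j (xs j) :=
    ae_all_iff.2 fun j =>
      (Measure.quasiMeasurePreserving_eval (μ := fun _ : Fin m => muHalf) j).ae (hfg j)
  have hpt : ∀ᵐ x ∂muHalf, ‖∫ xs, Q x xs * ∏ j, f j (xs j) ∂(piHalf m)‖ₑ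
      ≤ ∫⁻ y, ‖Q 1 y‖ₑ * ∏ j, ‖g j (x * y j)‖ₑ ∂(piHalf m) := by
    filter_upwards [(ae_restrict_mem measurableSet_Ioi : ∀ᵐ x ∂muHalf, x ∈ Ioi (0 : ℝ))] with x hx
    rw [← lintegral_kernel_eq hQ hhom (fun j => (hg j).measurable.enorm) hx]
    refine (enorm_integral_le_lintegral_enorm _).trans (lintegral_mono_ae ?_)
    filter_upwards [hae] with xs hxs
    simp only [hxs, enorm_mul, Real.enorm_eq_ofReal_abs, Finset.abs_prod,
      ENNReal.ofReal_prod_of_nonneg fun j _ => abs_nonneg _, le_refl]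
  have hQ1 : Measurable (Q 1) := hQ.comp measurable_prodMk_left
  have hG : Measurable (Function.uncurry fun (x : ℝ) (y : Fin m → ℝ) =>
      ∏ j, ‖g j (x * y j)‖ₑ) :=
    Finset.measurable_prod _ fun j _ => ((hg j).measurable.comp (by fun_prop)).enorm
  have key := lintegral_rpow_lintegral_mul_le (μ := muHalf) (ν := piHalf m) hq
    (K := fun y => ‖Q 1 y‖ₑ) (k := fun y => ENNReal.ofReal (∏ j, y j ^ (-(1 / p j))))
    (C := ∏ j, (∫⁻ x, ‖g j x‖ₑ ^ p j ∂muHalf) ^ (1 / p j)) hQ1.enorm (by fun_prop) hG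
    (by
      filter_upwards [ae_piHalf_pos m] with y hy
      refine ⟨?_, ENNReal.ofReal_ne_top⟩
      simpa using Finset.prod_pos fun j _ => Real.rpow_pos_of_pos (hy j) (-(1 / p j)))
    (by
      filter_upwards [ae_piHalf_pos m] with y hy
      exact lintegral_prod_comp_mul_rpow_le hp hq0 hqp (fun j => (hg j).measurable.enorm) hy)
  rw [← Theta_eq] at key
  rw [eLpNorm_ofReal_eq hq0]
  simp only [fun j => eLpNorm_congr_ae (p := ENNReal.ofReal (p j)) (hfg j),
    fun j => eLpNorm_ofReal_eq (μ := muHalf) (hp j) (g j)]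
  rw [one_div, ENNReal.rpow_inv_le_iff hq0]
  refine (lintegral_mono_ae ?_).trans key
  filter_upwards [hpt] with x hx using ENNReal.rpow_le_rpow hx hq0.le

theorem eLpNorm_le_mul_grandNorm {Ω : Type*} [MeasurableSpace Ω] {μ : Measure Ω} {a : ℝ}
    {b : ℝ≥0∞} {ψ : ℝ → ℝ} (f : Ω → ℝ) {r : ℝ} (hr : a < r ∧ ENNReal.ofReal r < b)
    (hψ : 0 < ψ r) :
    eLpNorm f (ENNReal.ofReal r) μ ≤ ENNReal.ofReal (ψ r) * grandNorm μ a b ψ f := by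
  rw [mul_comm, ← ENNReal.div_le_iff (by simpa using hψ) ENNReal.ofReal_ne_top]
  exact le_iSup (fun r : {r : ℝ // a < r ∧ ENNReal.ofReal r < b} =>
    eLpNorm f (ENNReal.ofReal r.1) μ / ENNReal.ofReal (ψ r.1)) ⟨r, hr⟩

/-- Grand Lebesgue estimate for the multilinear operator with homogeneous kernel:
if `fⱼ ∈ Gψⱼ(aⱼ,bⱼ)`, `pⱼ ∈ (aⱼ,bⱼ)`, `∑ 1/pⱼ = 1/p`, `p ≥ 1` and `Θ_m(p⃗) < ∞`, then
`‖M(f⃗)‖_{L^p(ℝ₊)} ≤ Θ_m(p⃗) · ∏ⱼ ψⱼ(pⱼ) ‖fⱼ‖_{Gψⱼ}`. -/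
theorem stmt10 (m : ℕ) (Q : ℝ → (Fin m → ℝ) → ℝ)
    (hQmeas : Measurable (fun z : ℝ × (Fin m → ℝ) => Q z.1 z.2))
    (hhom : ∀ δ > (0:ℝ), ∀ x > (0:ℝ), ∀ xs : Fin m → ℝ, (∀ j, 0 < xs j) →
      Q (δ * x) (fun j => δ * xs j) = δ ^ (-(m:ℝ)) * Q x xs)
    (a : Fin m → ℝ) (b : Fin m → ℝ≥0∞) (ha : ∀ j, 1 ≤ a j)
    (ψ : Fin m → ℝ → ℝ)
    (hψpos : ∀ j, ∃ c > (0:ℝ), ∀ p, a j < p → (ENNReal.ofReal p) < b j → c ≤ ψ j p)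
    (f : Fin m → ℝ → ℝ) (hfm : ∀ j, AEStronglyMeasurable (f j) muHalf)
    (hf : ∀ j, grandNorm muHalf (a j) (b j) (ψ j) (f j) < ∞)
    (p : Fin m → ℝ) (hp : ∀ j, a j < p j ∧ (ENNReal.ofReal (p j)) < b j)
    (q : ℝ) (hq : 1 ≤ q) (hqp : 1 / q = ∑ j, 1 / p j)
    (hTheta : Theta m Q p < ∞) :
    eLpNorm (fun x => ∫ xs, Q x xs * ∏ j, f j (xs j) ∂(piHalf m))
        (ENNReal.ofReal q) muHalf
      ≤ Theta m Q p * ∏ j,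
          ENNReal.ofReal (ψ j (p j)) * grandNorm muHalf (a j) (b j) (ψ j) (f j) := by
  have hp0 : ∀ j, 0 < p j := fun j => by linarith [ha j, (hp j).1]
  refine (eLpNorm_kernel_le hQmeas hhom hfm hp0 hq hqp).trans
    (mul_le_mul_right (Finset.prod_le_prod' fun j _ => ?_) _)
  obtain ⟨c, hc, hcψ⟩ := hψpos j
  exact eLpNorm_le_mul_grandNorm (f j) (hp j) (hc.trans_le (hcψ _ (hp j).1 (hp j).2))
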